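/- arXiv:math/0605280 — 3 statements merged into one kernel-verified Lean document; each statement's English description precedes it below -/
import Mathlib

section
/- (Hurwitz) Let A be a nontrivial finite-dimensional real normed vector space equipped with a bilinear multiplication μ : A →ₗ[ℝ] A →ₗ[ℝ] A and an element e ∈ A that is a two-sided unit (μ e x = x and μ x e = x for all x ∈ A), such that the norm is multiplicative: ‖μ x y‖ = ‖x‖ * ‖y‖ for all x, y ∈ A. Then the dimension of A over ℝ is 1, 2, 4 or 8. -/
section Parallelogram

open Polynomial in
/-- An endomorphism of a nonzero finite-dimensional real space has a complex eigenvalue `z`, in the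
sense that all real polynomials vanishing at `z` kill a common nonzero vector. -/
theorem exists_complex_forall_aeval_apply_eq_zero {V : Type*} [AddCommGroup V] [Module ℝ V]
    [FiniteDimensional ℝ V] [Nontrivial V] (T : Module.End ℝ V) :
    ∃ (z : ℂ) (v : V), v ≠ 0 ∧ ∀ p : ℝ[X], aeval z p = 0 → aeval T p v = 0 := by
  have hT : IsIntegral ℝ T := Algebra.IsIntegral.isIntegral T
  obtain ⟨z, hz⟩ := IsAlgClosed.exists_aeval_eq_zero ℂ (minpoly ℝ T) (minpoly.degree_pos hT).ne'
  obtain ⟨r, hr⟩ := minpoly.dvd ℝ z hz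
  have hr0 : r ≠ 0 := by
    rintro rfl
    exact minpoly.ne_zero hT (by rw [hr, mul_zero])
  have hrT : aeval T r ≠ 0 := fun h => by
    have hle := natDegree_le_of_dvd (minpoly.dvd ℝ T h) hr0
    have hz_int : IsIntegral ℝ z := Algebra.IsIntegral.isIntegral z
    rw [hr, natDegree_mul (minpoly.ne_zero hz_int) hr0] at hle
    have := minpoly.natDegree_pos hz_int
    omega
  obtain ⟨w, hw⟩ : ∃ w, aeval T r w ≠ 0 := by
    by_contra! h
    exact hrT (LinearMap.ext h)
  refine ⟨z, aeval T r w, hw, fun p hp => ?_⟩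
  obtain ⟨q, rfl⟩ := minpoly.dvd ℝ z hp
  have : aeval T (minpoly ℝ z * q * r) = 0 := by
    rw [mul_right_comm, ← hr, map_mul, minpoly.aeval, zero_mul]
  rw [← Module.End.mul_apply, ← map_mul, this, LinearMap.zero_apply]

open Polynomial in
/-- Every endomorphism of a nonzero finite-dimensional real space intertwines with multiplication
by a complex number along some nonzero real-linear map from `ℂ`. -/
theorem exists_complex_linearMap_intertwining {V : Type*} [AddCommGroup V] [Module ℝ V]
    [FiniteDimensional ℝ V] [Nontrivial V] (T : Module.End ℝ V) :
    ∃ (z : ℂ) (J : ℂ →ₗ[ℝ] V), J ≠ 0 ∧ ∀ w, T (J w) = J (z * w) := by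
  obtain ⟨z, v, hv, h⟩ := exists_complex_forall_aeval_apply_eq_zero T
  rcases eq_or_ne z.im 0 with hz | hz
  · have hTv : T v = z.re • v := by
      have := h (X - C z.re) (by simp [Complex.ext_iff, hz])
      simpa [sub_eq_zero, Module.algebraMap_end_apply] using this
    refine ⟨z, Complex.reLm.smulRight v, fun h0 => hv ?_, fun w => ?_⟩
    · simpa using congrArg (fun F : ℂ →ₗ[ℝ] V => F 1) h0
    · simp [hTv, hz, smul_smul, mul_comm]
  · have hTT : T (T v) = (2 * z.re) • T v - (z.re ^ 2 + z.im ^ 2) • v := by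
      have hquad (p q : ℝ) (hpq : aeval z (X ^ 2 - C p * X + C q) = 0) :
          T (T v) = p • T v - q • v := by
        have := h _ hpq
        simp only [map_add, map_sub, map_mul, aeval_X, aeval_C, LinearMap.add_apply,
          LinearMap.sub_apply, pow_two, Module.End.mul_apply, Module.algebraMap_end_apply] at this
        linear_combination (norm := module) this
      apply hquad
      simp [Complex.ext_iff, pow_two]
      constructor <;> ring
    refine ⟨z, Complex.reLm.smulRight v + Complex.imLm.smulRight (z.im⁻¹ • (T v - z.re • v)),
      fun h0 => hv ?_, fun w => ?_⟩
    · simpa using congrArg (fun F : ℂ →ₗ[ℝ] V => F 1) h0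
    · simp [hTT]
      match_scalars <;> field_simp <;> ring

theorem exists_norm_smul_add_smul_eq {A : Type*} [NormedAddCommGroup A] [NormedSpace ℝ A]
    [FiniteDimensional ℝ A] [Nontrivial A] {μ : A →ₗ[ℝ] A →ₗ[ℝ] A} {e : A}
    (he : ∀ x : A, μ e x = x) (hnorm : ∀ x y : A, ‖μ x y‖ = ‖x‖ * ‖y‖) (x : A) :
    ∃ z : ℂ, ∀ s t : ℝ, ‖s • e + t • x‖ = ‖(s + t * z : ℂ)‖ := by
  obtain ⟨z, J, hJ0, hJ⟩ := exists_complex_linearMap_intertwining (μ x)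
  refine ⟨z, fun s t => ?_⟩
  let L : ℂ →L[ℝ] A := LinearMap.toContinuousLinearMap J
  have hL : 0 < ‖L‖ := norm_pos_iff.2 fun h => hJ0 (by
    ext1 w; exact congrArg (fun F : ℂ →L[ℝ] A => F w) h)
  set c := ‖s • e + t • x‖
  set κ : ℂ := s + t * z with hκ
  have hscale : ∀ w, c * ‖L w‖ = ‖L (κ * w)‖ := fun w => by
    have hw : κ * w = s • w + t • (z * w) := by
      simp [hκ, add_mul, mul_assoc]
    change c * ‖J w‖ = ‖J (κ * w)‖
    rw [← hnorm, hw, map_add J, map_smul J, map_smul J, ← hJ]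
    simp [he]
  apply le_antisymm
  · refine le_of_mul_le_mul_right ?_ hL
    rw [← norm_smul_of_nonneg (norm_nonneg _)]
    refine ContinuousLinearMap.opNorm_le_bound _ (by positivity) fun w => ?_
    calc ‖c • L w‖ = ‖L (κ * w)‖ := by
          rw [norm_smul_of_nonneg (norm_nonneg _), hscale]
      _ ≤ ‖L‖ * ‖κ * w‖ := L.le_opNorm _
      _ = ‖κ‖ * ‖L‖ * ‖w‖ := by rw [norm_mul]; ring
  · rcases eq_or_ne κ 0 with h0 | h0
    · rw [h0, norm_zero]
      exact norm_nonneg _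
    refine le_of_mul_le_mul_right ?_ hL
    rw [← norm_smul_of_nonneg (norm_nonneg _)]
    refine ContinuousLinearMap.opNorm_le_bound _ (by positivity) fun w => ?_
    calc ‖‖κ‖ • L w‖ = ‖κ‖ * (c * ‖L (κ⁻¹ * w)‖) := by
          rw [norm_smul_of_nonneg (norm_nonneg _), hscale, mul_inv_cancel_left₀ h0]
      _ ≤ ‖κ‖ * (c * (‖L‖ * ‖κ⁻¹ * w‖)) := by
          gcongr
          exact L.le_opNorm _
      _ = c * ‖L‖ * ‖w‖ := by
          rw [norm_mul, norm_inv]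
          have := norm_ne_zero_iff.2 h0
          field_simp

theorem parallelogram_law_of_norm_mul {A : Type*} [NormedAddCommGroup A] [NormedSpace ℝ A]
    [FiniteDimensional ℝ A] {μ : A →ₗ[ℝ] A →ₗ[ℝ] A} {e : A}
    (he : ∀ x : A, μ e x = x) (he' : ∀ x : A, μ x e = x)
    (hnorm : ∀ x y : A, ‖μ x y‖ = ‖x‖ * ‖y‖) (x y : A) :
    ‖x + y‖ * ‖x + y‖ + ‖x - y‖ * ‖x - y‖ = 2 * (‖x‖ * ‖x‖ + ‖y‖ * ‖y‖) := by
  rcases eq_or_ne x 0 with rfl | hx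
  · simp; ring
  have : Nontrivial A := ⟨x, 0, hx⟩
  have hinj : Function.Injective (μ x) := (injective_iff_map_eq_zero _).2 fun y hy => by
    rw [← norm_eq_zero, hnorm] at hy
    simpa [hx] using hy
  obtain ⟨u, rfl⟩ := LinearMap.surjective_of_injective hinj y
  obtain ⟨z, hz⟩ := exists_norm_smul_add_smul_eq he hnorm u
  have h₁ : ‖e + u‖ = ‖1 + z‖ := by simpa using hz 1 1
  have h₂ : ‖e - u‖ = ‖1 - z‖ := by simpa [← sub_eq_add_neg] using hz 1 (-1)
  have h₃ : ‖u‖ = ‖z‖ := by simpa using hz 0 1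
  have hadd : ‖x + μ x u‖ = ‖x‖ * ‖1 + z‖ := by rw [← h₁, ← hnorm, map_add, he']
  have hsub : ‖x - μ x u‖ = ‖x‖ * ‖1 - z‖ := by rw [← h₂, ← hnorm, map_sub, he']
  have hpar := parallelogram_law_with_norm ℝ (1 : ℂ) z
  rw [norm_one] at hpar
  rw [hadd, hsub, hnorm, h₃]
  linear_combination ‖x‖ ^ 2 * hpar

end Parallelogram

section Composition

open scoped RealInnerProductSpace

variable {A : Type*} [NormedAddCommGroup A] [InnerProductSpace ℝ A]
  {μ : A →ₗ[ℝ] A →ₗ[ℝ] A} {e : A}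

theorem inner_mul_left_mul_left (hnorm : ∀ x y : A, ‖μ x y‖ = ‖x‖ * ‖y‖) (a x y : A) :
    ⟪μ a x, μ a y⟫ = ‖a‖ ^ 2 * ⟪x, y⟫ := by
  rw [real_inner_eq_norm_add_mul_self_sub_norm_mul_self_sub_norm_mul_self_div_two,
    real_inner_eq_norm_add_mul_self_sub_norm_mul_self_sub_norm_mul_self_div_two, ← map_add]
  simp only [hnorm]
  ring

theorem inner_mul_right_mul_right (hnorm : ∀ x y : A, ‖μ x y‖ = ‖x‖ * ‖y‖) (a x y : A) :
    ⟪μ x a, μ y a⟫ = ‖a‖ ^ 2 * ⟪x, y⟫ := by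
  have := inner_mul_left_mul_left (μ := μ.flip) (fun x y => by simp [hnorm, mul_comm]) a x y
  simpa using this

theorem inner_mul_left_eq_neg (he : ∀ x : A, μ e x = x)
    (hnorm : ∀ x y : A, ‖μ x y‖ = ‖x‖ * ‖y‖) {a : A} (ha : ⟪a, e⟫ = 0) (x y : A) :
    ⟪μ a x, y⟫ = -⟪x, μ a y⟫ := by
  have h := inner_mul_left_mul_left hnorm (a + e) x y
  have h₁ := inner_mul_left_mul_left hnorm a x y
  have h₂ := inner_mul_left_mul_left hnorm e x y
  simp only [map_add, LinearMap.add_apply, he, inner_add_left, inner_add_right,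
    norm_add_sq_real, ha] at h h₁ h₂
  linarith

theorem mul_mul_self (he : ∀ x : A, μ e x = x)
    (hnorm : ∀ x y : A, ‖μ x y‖ = ‖x‖ * ‖y‖) {a : A} (ha : ⟪a, e⟫ = 0) (x : A) :
    μ a (μ a x) = -‖a‖ ^ 2 • x := by
  refine ext_inner_right ℝ fun y => ?_
  rw [inner_mul_left_eq_neg he hnorm ha, inner_mul_left_mul_left hnorm, real_inner_smul_left]
  ring

theorem mul_mul_eq_neg (he : ∀ x : A, μ e x = x)
    (hnorm : ∀ x y : A, ‖μ x y‖ = ‖x‖ * ‖y‖) {a b : A} (ha : ⟪a, e⟫ = 0) (hb : ⟪b, e⟫ = 0)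
    (hab : ⟪a, b⟫ = 0) (x : A) : μ a (μ b x) = -μ b (μ a x) := by
  have h := mul_mul_self he hnorm (a := a + b) (by rw [inner_add_left, ha, hb, add_zero]) x
  rw [norm_add_sq_real, hab] at h
  simp only [map_add, LinearMap.add_apply, mul_mul_self he hnorm ha,
    mul_mul_self he hnorm hb] at h
  linear_combination (norm := module) h

theorem mul_eq_neg_mul (he : ∀ x : A, μ e x = x) (he' : ∀ x : A, μ x e = x)
    (hnorm : ∀ x y : A, ‖μ x y‖ = ‖x‖ * ‖y‖) {a b : A} (ha : ⟪a, e⟫ = 0) (hb : ⟪b, e⟫ = 0)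
    (hab : ⟪a, b⟫ = 0) : μ a b = -μ b a := by
  simpa [he'] using mul_mul_eq_neg he hnorm ha hb hab e

theorem inner_mul_unit_eq_zero (he : ∀ x : A, μ e x = x) (he' : ∀ x : A, μ x e = x)
    (hnorm : ∀ x y : A, ‖μ x y‖ = ‖x‖ * ‖y‖) {a b : A} (ha : ⟪a, e⟫ = 0)
    (hab : ⟪a, b⟫ = 0) : ⟪μ a b, e⟫ = 0 := by
  rw [inner_mul_left_eq_neg he hnorm ha, he', real_inner_comm, hab, neg_zero]

/-- Antiassociativity of imaginary elements `a, b, u` for which `u` is orthogonal to `ab`. -/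
theorem mul_mul_eq_neg_mul_mul (he : ∀ x : A, μ e x = x) (he' : ∀ x : A, μ x e = x)
    (hnorm : ∀ x y : A, ‖μ x y‖ = ‖x‖ * ‖y‖) {a b u : A} (ha : ⟪a, e⟫ = 0) (hb : ⟪b, e⟫ = 0)
    (hu : ⟪u, e⟫ = 0) (hab : ⟪a, b⟫ = 0) (hau : ⟪a, u⟫ = 0) (hbu : ⟪b, u⟫ = 0)
    (habu : ⟪μ a b, u⟫ = 0) : μ a (μ b u) = -μ (μ a b) u := by
  rw [mul_eq_neg_mul he he' hnorm hb hu hbu, map_neg, mul_mul_eq_neg he hnorm ha hu hau,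
    mul_eq_neg_mul he he' hnorm (inner_mul_unit_eq_zero he he' hnorm ha hab) hu habu, neg_neg]

theorem exists_ne_zero_forall_inner_eq_zero [FiniteDimensional ℝ A] {k : ℕ}
    (hk : k < Module.finrank ℝ A) (v : Fin k → A) : ∃ u : A, u ≠ 0 ∧ ∀ i, ⟪v i, u⟫ = 0 := by
  have hlt : Module.finrank ℝ (Submodule.span ℝ (Set.range v)) < Module.finrank ℝ A :=
    (finrank_range_le_card v).trans_lt (by simpa using hk)
  have hne : (Submodule.span ℝ (Set.range v))ᗮ ≠ ⊥ := by
    rw [Ne, Submodule.orthogonal_eq_bot_iff]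
    intro h
    rw [h, finrank_top] at hlt
    exact hlt.false
  obtain ⟨u, hu, hu0⟩ := Submodule.exists_mem_ne_zero_of_ne_bot hne
  exact ⟨u, hu0, fun i => hu _ (Submodule.subset_span ⟨i, rfl⟩)⟩

theorem le_finrank_of_pairwise_inner_eq_zero [FiniteDimensional ℝ A] {k : ℕ} {v : Fin k → A}
    (hv : ∀ i, v i ≠ 0) (h : ∀ i j, i < j → ⟪v i, v j⟫ = 0) : k ≤ Module.finrank ℝ A := by
  have hp : Pairwise fun i j => ⟪v i, v j⟫ = 0 := fun i j hij =>
    hij.lt_or_gt.elim (h i j) fun hji => (real_inner_comm _ _).trans (h j i hji)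
  simpa using (linearIndependent_of_ne_zero_of_inner_eq_zero hv hp).fintype_card_le_finrank

theorem inner_mul_eq_zero_left (he' : ∀ x : A, μ x e = x)
    (hnorm : ∀ x y : A, ‖μ x y‖ = ‖x‖ * ‖y‖) (a : A) {b : A} (hb : ⟪b, e⟫ = 0) :
    ⟪a, μ a b⟫ = 0 := by
  have h := inner_mul_left_mul_left hnorm a e b
  rwa [he', real_inner_comm, real_inner_comm b e, hb, mul_zero, real_inner_comm] at h

theorem inner_mul_eq_zero_right (he : ∀ x : A, μ e x = x)
    (hnorm : ∀ x y : A, ‖μ x y‖ = ‖x‖ * ‖y‖) {a : A} (b : A) (ha : ⟪a, e⟫ = 0) :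
    ⟪b, μ a b⟫ = 0 :=
  inner_mul_eq_zero_left (μ := μ.flip) he (fun x y => by simp [hnorm, mul_comm]) b ha

theorem mul_ne_zero_of_norm_mul (hnorm : ∀ x y : A, ‖μ x y‖ = ‖x‖ * ‖y‖) {x y : A}
    (hx : x ≠ 0) (hy : y ≠ 0) : μ x y ≠ 0 := by
  rw [← norm_ne_zero_iff, hnorm]
  exact mul_ne_zero (norm_ne_zero_iff.2 hx) (norm_ne_zero_iff.2 hy)

/-- If `e, i, j` are orthogonal and nonzero, then so are `e, i, j, ij`. -/
theorem four_le_finrank [FiniteDimensional ℝ A] (he : ∀ x : A, μ e x = x)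
    (he' : ∀ x : A, μ x e = x) (hnorm : ∀ x y : A, ‖μ x y‖ = ‖x‖ * ‖y‖) {i j : A}
    (he0 : e ≠ 0) (hi0 : i ≠ 0) (hj0 : j ≠ 0) (hi : ⟪i, e⟫ = 0) (hj : ⟪j, e⟫ = 0)
    (hij : ⟪i, j⟫ = 0) : 4 ≤ Module.finrank ℝ A := by
  have hk := inner_mul_unit_eq_zero he he' hnorm hi hij
  have hik := inner_mul_eq_zero_left he' hnorm i hj
  have hjk := inner_mul_eq_zero_right he hnorm j hi
  rw [real_inner_comm] at hi hj hk
  refine le_finrank_of_pairwise_inner_eq_zero (v := ![e, i, j, μ i j]) ?_ ?_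
  · simp [Fin.forall_fin_succ, he0, hi0, hj0, mul_ne_zero_of_norm_mul hnorm]
  · simp [Fin.forall_fin_succ, hi, hj, hk, hij, hik, hjk]

/-- If `e, i, j, l` are orthogonal and nonzero and `l` is orthogonal to `ij`, then
`e, i, j, ij, l, il, jl, (ij)l` are orthogonal and nonzero. -/
theorem eight_le_finrank [FiniteDimensional ℝ A] (he : ∀ x : A, μ e x = x)
    (he' : ∀ x : A, μ x e = x) (hnorm : ∀ x y : A, ‖μ x y‖ = ‖x‖ * ‖y‖) {i j l : A}
    (he0 : e ≠ 0) (hi0 : i ≠ 0) (hj0 : j ≠ 0) (hl0 : l ≠ 0) (hi : ⟪i, e⟫ = 0)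
    (hj : ⟪j, e⟫ = 0) (hl : ⟪l, e⟫ = 0) (hij : ⟪i, j⟫ = 0) (hil : ⟪i, l⟫ = 0)
    (hjl : ⟪j, l⟫ = 0) (hkl : ⟪μ i j, l⟫ = 0) : 8 ≤ Module.finrank ℝ A := by
  have hk := inner_mul_unit_eq_zero he he' hnorm hi hij
  have hik := inner_mul_eq_zero_left he' hnorm i hj
  have hjk := inner_mul_eq_zero_right he hnorm j hi
  have hji := mul_eq_neg_mul he he' hnorm hj hi (by rw [real_inner_comm, hij])
  have hiij := mul_mul_self he hnorm hi j
  have hjij : μ j (μ i j) = ‖j‖ ^ 2 • i := by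
    rw [mul_eq_neg_mul he he' hnorm hi hj hij, map_neg, mul_mul_self he hnorm hj, neg_smul,
      neg_neg]
  have hk0 := mul_ne_zero_of_norm_mul hnorm hi0 hj0
  generalize hkdef : μ i j = k at *
  have hki := mul_eq_neg_mul he he' hnorm hk hi (by rw [real_inner_comm, hik])
  have hkj := mul_eq_neg_mul he he' hnorm hk hj (by rw [real_inner_comm, hjk])
  have hsq : ∀ x : A, ⟪x, e⟫ = 0 → μ x x = -‖x‖ ^ 2 • e := fun x hx => by
    simpa [he'] using mul_mul_self he hnorm hx e
  have hsymm : ∀ x y z : A, ⟪y, e⟫ = 0 → ⟪μ y x, z⟫ = 0 → ⟪x, μ y z⟫ = 0 := fun x y z hy h => by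
    rwa [inner_mul_left_eq_neg he hnorm hy, neg_eq_zero] at h
  have hr : ∀ x y : A, ⟪x, y⟫ = 0 → ⟪μ x l, μ y l⟫ = 0 := fun x y h => by
    rw [inner_mul_right_mul_right hnorm, h, mul_zero]
  have hl' : ⟪e, l⟫ = 0 := by rw [real_inner_comm, hl]
  have h0 : ∀ x : A, x ≠ 0 → μ x l ≠ 0 := fun x hx => mul_ne_zero_of_norm_mul hnorm hx hl0
  refine le_finrank_of_pairwise_inner_eq_zero
    (v := ![e, i, j, k, l, μ i l, μ j l, μ k l]) ?_ ?_
  · simp [Fin.forall_fin_succ, he0, hi0, hj0, hk0, hl0, h0]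
  · have hi' : ⟪e, i⟫ = 0 := by rw [real_inner_comm, hi]
    have hj' : ⟪e, j⟫ = 0 := by rw [real_inner_comm, hj]
    have hk' : ⟪e, k⟫ = 0 := by rw [real_inner_comm, hk]
    simp [Fin.forall_fin_succ, hi', hj', hk', hl', hij, hik, hil, hjk, hjl, hkl,
      inner_mul_eq_zero_right he hnorm, hi, hj, hk, hr, hsymm, he', hsq, hkdef, hji, hki, hkj,
      hiij, hjij, real_inner_smul_left, inner_neg_left]

/-- No nonzero element is orthogonal to the eight elements generated by `i, j, l`. -/
theorem eq_zero_of_orthogonal (he : ∀ x : A, μ e x = x)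
    (he' : ∀ x : A, μ x e = x) (hnorm : ∀ x y : A, ‖μ x y‖ = ‖x‖ * ‖y‖) {i j l m : A}
    (hi0 : i ≠ 0) (hj0 : j ≠ 0) (hl0 : l ≠ 0) (hi : ⟪i, e⟫ = 0)
    (hj : ⟪j, e⟫ = 0) (hl : ⟪l, e⟫ = 0) (hm : ⟪m, e⟫ = 0) (hij : ⟪i, j⟫ = 0) (hil : ⟪i, l⟫ = 0)
    (hjl : ⟪j, l⟫ = 0) (hkl : ⟪μ i j, l⟫ = 0) (him : ⟪i, m⟫ = 0) (hjm : ⟪j, m⟫ = 0)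
    (hkm : ⟪μ i j, m⟫ = 0) (hlm : ⟪l, m⟫ = 0) (hilm : ⟪μ i l, m⟫ = 0) (hjlm : ⟪μ j l, m⟫ = 0)
    (hklm : ⟪μ (μ i j) l, m⟫ = 0) : m = 0 := by
  by_contra hm0
  have anti := @mul_mul_eq_neg_mul_mul A _ _ μ e he he' hnorm
  have hk := inner_mul_unit_eq_zero he he' hnorm hi hij
  have horth : ∀ x : A, ⟪x, e⟫ = 0 → ⟪x, l⟫ = 0 → ⟪μ x l, m⟫ = 0 → ⟪x, μ l m⟫ = 0 :=
    fun x hx hxl h => by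
      rw [mul_eq_neg_mul he he' hnorm hx hl hxl, inner_neg_left,
        inner_mul_left_eq_neg he hnorm hl, neg_neg] at h
      exact h
  have hijl : μ i (μ j l) = -μ (μ i j) l := anti hi hj hl hij hil hjl hkl
  have hi_jl : ⟪i, μ j l⟫ = 0 := by
    rw [← neg_eq_zero, ← inner_mul_left_eq_neg he hnorm hj,
      mul_eq_neg_mul he he' hnorm hj hi (by rw [real_inner_comm, hij]), inner_neg_left, hkl,
      neg_zero]
  have h₁ : μ i (μ j (μ l m)) = -μ (μ (μ i j) l) m := by
    rw [anti hj hl hm hjl hjm hlm hjlm, map_neg,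
      anti hi (inner_mul_unit_eq_zero he he' hnorm hj hjl) hm hi_jl him hjlm
        (by rw [hijl, inner_neg_left, hklm, neg_zero]), hijl]
    simp
  have h₂ : μ i (μ j (μ l m)) = μ (μ (μ i j) l) m := by
    rw [anti hi hj (inner_mul_unit_eq_zero he he' hnorm hl hlm) hij (horth i hi hil hilm)
      (horth j hj hjl hjlm) (horth _ hk hkl hklm), anti hk hl hm hkl hkm hlm hklm, neg_neg]
  have hne := mul_ne_zero_of_norm_mul hnorm (mul_ne_zero_of_norm_mul hnorm
    (mul_ne_zero_of_norm_mul hnorm hi0 hj0) hl0) hm0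
  exact hne (by linear_combination (norm := module) (1 / 2 : ℝ) • h₂.symm.trans h₁)

theorem finrank_of_norm_mul_inner [FiniteDimensional ℝ A] [Nontrivial A]
    (he : ∀ x : A, μ e x = x) (he' : ∀ x : A, μ x e = x)
    (hnorm : ∀ x y : A, ‖μ x y‖ = ‖x‖ * ‖y‖) :
    Module.finrank ℝ A = 1 ∨ Module.finrank ℝ A = 2 ∨
    Module.finrank ℝ A = 4 ∨ Module.finrank ℝ A = 8 := by
  have he0 : e ≠ 0 := by
    rintro rfl
    obtain ⟨x, hx⟩ := exists_ne (0 : A)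
    exact hx (by simpa using (he x).symm)
  have hpos : 0 < Module.finrank ℝ A := Module.finrank_pos
  by_cases h₁ : Module.finrank ℝ A ≤ 1
  · omega
  obtain ⟨i, hi0, hi⟩ := exists_ne_zero_forall_inner_eq_zero (not_le.1 h₁) ![e]
  by_cases h₂ : Module.finrank ℝ A ≤ 2
  · omega
  obtain ⟨j, hj0, hj⟩ := exists_ne_zero_forall_inner_eq_zero (not_le.1 h₂) ![e, i]
  simp only [Fin.forall_fin_succ, Matrix.cons_val_zero, Matrix.cons_val_succ,
    IsEmpty.forall_iff, and_true] at hi hj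
  obtain ⟨hj, hij⟩ := hj
  rw [real_inner_comm] at hi hj
  have h4 := four_le_finrank he he' hnorm he0 hi0 hj0 hi hj hij
  by_cases h₄ : Module.finrank ℝ A ≤ 4
  · omega
  obtain ⟨l, hl0, hl⟩ := exists_ne_zero_forall_inner_eq_zero (not_le.1 h₄) ![e, i, j, μ i j]
  simp only [Fin.forall_fin_succ, Matrix.cons_val_zero, Matrix.cons_val_succ,
    IsEmpty.forall_iff, and_true] at hl
  obtain ⟨hl, hil, hjl, hkl⟩ := hl
  rw [real_inner_comm] at hl
  have h8 := eight_le_finrank he he' hnorm he0 hi0 hj0 hl0 hi hj hl hij hil hjl hkl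
  by_cases h₈ : Module.finrank ℝ A ≤ 8
  · omega
  obtain ⟨m, hm0, hm⟩ := exists_ne_zero_forall_inner_eq_zero (not_le.1 h₈)
    ![e, i, j, μ i j, l, μ i l, μ j l, μ (μ i j) l]
  simp only [Fin.forall_fin_succ, Matrix.cons_val_zero, Matrix.cons_val_succ,
    IsEmpty.forall_iff, and_true] at hm
  obtain ⟨hm, him, hjm, hkm, hlm, hilm, hjlm, hklm⟩ := hm
  rw [real_inner_comm] at hm
  exact (hm0 (eq_zero_of_orthogonal he he' hnorm hi0 hj0 hl0 hi hj hl hm hij hil hjl hkl him hjm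
    hkm hlm hilm hjlm hklm)).elim

end Composition


/-- **Hurwitz' theorem.**
A nontrivial finite-dimensional real normed vector space with a bilinear multiplication
`μ`, a two-sided unit `e`, and multiplicative norm `‖μ x y‖ = ‖x‖ * ‖y‖` has real
dimension 1, 2, 4 or 8. -/
theorem hurwitz_normed_division_algebra
    (A : Type*) [NormedAddCommGroup A] [NormedSpace ℝ A]
    [FiniteDimensional ℝ A] [Nontrivial A]
    (μ : A →ₗ[ℝ] A →ₗ[ℝ] A) (e : A)
    (he : ∀ x : A, μ e x = x ∧ μ x e = x)
    (hnorm : ∀ x y : A, ‖μ x y‖ = ‖x‖ * ‖y‖) :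
    Module.finrank ℝ A = 1 ∨ Module.finrank ℝ A = 2 ∨
    Module.finrank ℝ A = 4 ∨ Module.finrank ℝ A = 8 := by
  let _ : InnerProductSpace ℝ A := InnerProductSpace.ofNorm ℝ
    (parallelogram_law_of_norm_mul (fun x => (he x).1) (fun x => (he x).2) hnorm)
  exact finrank_of_norm_mul_inner (fun x => (he x).1) (fun x => (he x).2) hnorm
end

section
/- Let V be a finite-dimensional real normed vector space and S = {x ∈ V : ‖x‖ = 1} its unit sphere. Suppose that for every pair x, y ∈ S there exists a linear map L : V → V such that L maps S into S and L x = y. Then the norm of V satisfies the parallelogram law: ‖x + y‖² + ‖x − y‖² = 2‖x‖² + 2‖y‖² for all x, y ∈ V; hence the norm is induced by an inner product on V. -/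
open MeasureTheory Metric Module in
/-- The squared seminorm on `V` given by integrating `f ↦ (f x) ^ 2` over the dual unit ball. -/
noncomputable def dualBallMoment (V : Type*) [NormedAddCommGroup V] [NormedSpace ℝ V]
    [MeasurableSpace (StrongDual ℝ V)] [BorelSpace (StrongDual ℝ V)] (x : V) : ℝ :=
  ∫ f in closedBall (0 : StrongDual ℝ V) 1, (f x) ^ 2 ∂μH[finrank ℝ (StrongDual ℝ V)]

/-- Precomposition with a linear isometry equivalence, as an isometry of the dual space. -/
noncomputable def LinearIsometryEquiv.precompDual {V : Type*} [NormedAddCommGroup V]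
    [NormedSpace ℝ V] (e : V ≃ₗᵢ[ℝ] V) : StrongDual ℝ V ≃ₗᵢ[ℝ] StrongDual ℝ V where
  toLinearEquiv := (e.symm.toContinuousLinearEquiv.arrowCongr
    (ContinuousLinearEquiv.refl ℝ ℝ)).toLinearEquiv
  norm_map' f := ContinuousLinearMap.opNorm_comp_linearIsometryEquiv f e

theorem LinearIsometryEquiv.precompDual_apply {V : Type*} [NormedAddCommGroup V]
    [NormedSpace ℝ V] (e : V ≃ₗᵢ[ℝ] V) (f : StrongDual ℝ V) (x : V) :
    e.precompDual f x = f (e x) :=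
  rfl

section dualBallMoment

open MeasureTheory Metric Module

variable {V : Type*} [NormedAddCommGroup V] [NormedSpace ℝ V]
  [MeasurableSpace (StrongDual ℝ V)] [BorelSpace (StrongDual ℝ V)]

theorem dualBallMoment_map (e : V ≃ₗᵢ[ℝ] V) (x : V) :
    dualBallMoment V (e x) = dualBallMoment V x := by
  have key := (e.precompDual.toIsometryEquiv.measurePreserving_hausdorffMeasure
    (finrank ℝ (StrongDual ℝ V))).setIntegral_preimage_emb
    e.precompDual.toHomeomorph.measurableEmbedding
    (fun f : StrongDual ℝ V => (f x) ^ 2) (closedBall 0 1)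
  have hball : e.precompDual.toIsometryEquiv ⁻¹' closedBall 0 1
      = closedBall (0 : StrongDual ℝ V) 1 := by
    ext f
    simp
  rw [hball] at key
  exact key

theorem dualBallMoment_smul (c : ℝ) (x : V) :
    dualBallMoment V (c • x) = c ^ 2 * dualBallMoment V x := by
  simp only [dualBallMoment, map_smul, smul_eq_mul, mul_pow, integral_const_mul]

variable [FiniteDimensional ℝ V]

theorem integrableOn_sq_apply_closedBall (x : V) :
    IntegrableOn (fun f : StrongDual ℝ V => (f x) ^ 2) (closedBall 0 1)
      μH[finrank ℝ (StrongDual ℝ V)] := by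
  have : ProperSpace (StrongDual ℝ V) := FiniteDimensional.proper ℝ _
  exact ContinuousOn.integrableOn_compact (isCompact_closedBall _ _) (by fun_prop)

theorem dualBallMoment_parallelogram (x y : V) :
    dualBallMoment V (x + y) + dualBallMoment V (x - y)
      = 2 * dualBallMoment V x + 2 * dualBallMoment V y := by
  have hx := integrableOn_sq_apply_closedBall x
  have hy := integrableOn_sq_apply_closedBall y
  simp only [dualBallMoment]
  rw [← integral_add (integrableOn_sq_apply_closedBall _) (integrableOn_sq_apply_closedBall _),
    ← integral_const_mul, ← integral_const_mul, ← integral_add (hx.const_mul 2) (hy.const_mul 2)]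
  congr 1 with f
  simp only [map_add, map_sub]
  ring

theorem dualBallMoment_pos {x : V} (hx : x ≠ 0) : 0 < dualBallMoment V x := by
  refine (setIntegral_pos_iff_support_of_nonneg_ae
    (Filter.Eventually.of_forall fun f : StrongDual ℝ V => sq_nonneg (f x))
    (integrableOn_sq_apply_closedBall x)).mpr ?_
  have hopen : IsOpen ({f : StrongDual ℝ V | f x ≠ 0} ∩ ball 0 1) :=
    (isOpen_ne_fun (by fun_prop) continuous_const).inter isOpen_ball
  obtain ⟨g, hg, hgx⟩ := exists_dual_vector ℝ x (norm_ne_zero_iff.mpr hx)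
  have hne : ({f : StrongDual ℝ V | f x ≠ 0} ∩ ball 0 1).Nonempty := by
    refine ⟨(2⁻¹ : ℝ) • g, ?_, ?_⟩
    · simp [hgx, hx]
    · rw [mem_ball_zero_iff, norm_smul, hg]
      norm_num
  refine (hopen.measure_pos _ hne).trans_le (measure_mono ?_)
  rintro f ⟨hf, hfb⟩
  exact ⟨pow_ne_zero 2 hf, ball_subset_closedBall hfb⟩

end dualBallMoment

theorem LinearMap.norm_map_of_norm_one {V W : Type*} [NormedAddCommGroup V] [NormedSpace ℝ V]
    [NormedAddCommGroup W] [NormedSpace ℝ W] (L : V →ₗ[ℝ] W)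
    (hL : ∀ z, ‖z‖ = 1 → ‖L z‖ = 1) (z : V) : ‖L z‖ = ‖z‖ := by
  rcases eq_or_ne z 0 with rfl | hz
  · simp
  · have hz' : ‖z‖ ≠ 0 := norm_ne_zero_iff.mpr hz
    have h1 := hL (‖z‖⁻¹ • z) (by simp [norm_smul, hz'])
    rw [map_smul, norm_smul, norm_inv, norm_norm] at h1
    field_simp at h1
    exact h1

/-- **Norms with a transitive sphere-preserving family of operators are inner-product
norms.** If for every pair of points `x, y` on the unit sphere of a finite-dimensional
real normed space `V` there is a linear map `L : V → V` mapping the unit sphere into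
itself with `L x = y`, then the norm satisfies the parallelogram law (hence comes from an
inner product). -/
theorem parallelogram_of_transitive_sphere
    (V : Type*) [NormedAddCommGroup V] [NormedSpace ℝ V] [FiniteDimensional ℝ V]
    (h : ∀ x y : V, ‖x‖ = 1 → ‖y‖ = 1 →
      ∃ L : V →ₗ[ℝ] V, (∀ z : V, ‖z‖ = 1 → ‖L z‖ = 1) ∧ L x = y) :
    ∀ x y : V, ‖x + y‖ ^ 2 + ‖x - y‖ ^ 2 = 2 * ‖x‖ ^ 2 + 2 * ‖y‖ ^ 2 := by
  borelize (StrongDual ℝ V)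
  intro x y
  by_cases hV : ∃ u : V, ‖u‖ = 1
  · obtain ⟨u, hu⟩ := hV
    have hc : 0 < dualBallMoment V u := dualBallMoment_pos (norm_ne_zero_iff.mp (by simp [hu]))
    have hsphere (z : V) (hz : ‖z‖ = 1) : dualBallMoment V z = dualBallMoment V u := by
      obtain ⟨L, hL, rfl⟩ := h u z hu hz
      let l : V →ₗᵢ[ℝ] V := ⟨L, L.norm_map_of_norm_one hL⟩
      exact dualBallMoment_map (l.toLinearIsometryEquiv rfl) u
    have hnorm (z : V) : dualBallMoment V z = ‖z‖ ^ 2 * dualBallMoment V u := by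
      rcases eq_or_ne z 0 with rfl | hz
      · simp [dualBallMoment]
      · have hz' : ‖z‖ ≠ 0 := norm_ne_zero_iff.mpr hz
        rw [← hsphere (‖z‖⁻¹ • z) (by simp [norm_smul, hz']), ← dualBallMoment_smul,
          smul_inv_smul₀ hz']
    have hpar := dualBallMoment_parallelogram x y
    rw [hnorm (x + y), hnorm (x - y), hnorm x, hnorm y] at hpar
    refine mul_right_cancel₀ hc.ne' ?_
    linear_combination hpar
  · have hzero (z : V) : z = 0 := by
      by_contra hz
      exact hV ⟨‖z‖⁻¹ • z, by simp [norm_smul, hz]⟩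
    simp [hzero x, hzero y]
end

section
/- (Radon–Hurwitz) Let N, t, a, b be natural numbers with b ≤ 3 and N + 1 = (2t + 1) · 2^(4a + b), and set n := 8a + 2^b − 1. Then there exists a family of continuous maps V : Fin n → (S^N → ℝ^(N+1)), where S^N is the unit sphere in the Euclidean space ℝ^(N+1), such that for every point x ∈ S^N: (i) ⟪V i x, x⟫ = 0 for each i (each V i is a tangent vector field on S^N), and (ii) the family of vectors (V i x)_{i : Fin n} is linearly independent over ℝ. In particular there exist n pointwise linearly independent tangent vector fields on S^N. -/
open scoped RealInnerProductSpace

open scoped Kronecker Matrix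

namespace Matrix

variable {l m n p R : Type*} [CommRing R]

lemma neg_kronecker (A : Matrix l m R) (B : Matrix n p R) : (-A) ⊗ₖ B = -(A ⊗ₖ B) := by
  ext; simp

lemma kronecker_neg (A : Matrix l m R) (B : Matrix n p R) : A ⊗ₖ (-B) = -(A ⊗ₖ B) := by
  ext; simp

lemma mulVec_dotProduct_eq_zero [Fintype n] {M : Matrix n n ℝ} (hM : Mᵀ = -M) (v : n → ℝ) :
    M *ᵥ v ⬝ᵥ v = 0 := by
  have h : M *ᵥ v ⬝ᵥ v = -(M *ᵥ v ⬝ᵥ v) := by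
    conv_lhs => rw [dotProduct_comm, dotProduct_mulVec, ← mulVec_transpose, hM,
      neg_mulVec, neg_dotProduct]
  linarith

end Matrix

/-- A Hurwitz–Radon family: skew-symmetric, pairwise anticommuting matrices squaring to `-1`. -/
structure IsHurwitzRadon {ι n R : Type*} [Fintype n] [DecidableEq n] [CommRing R]
    (A : ι → Matrix n n R) : Prop where
  transpose_eq : ∀ i, (A i)ᵀ = -A i
  mul_self : ∀ i, A i * A i = -1
  anticomm : ∀ i j, i ≠ j → A i * A j = -(A j * A i)

namespace IsHurwitzRadon

variable {ι κ n m R S : Type*} [Fintype n] [DecidableEq n] [Fintype m] [DecidableEq m]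
  [CommRing R] [CommRing S]

lemma of_isEmpty [IsEmpty ι] (A : ι → Matrix n n R) : IsHurwitzRadon A :=
  ⟨isEmptyElim, isEmptyElim, isEmptyElim⟩

lemma map {A : ι → Matrix n n R} (hA : IsHurwitzRadon A) (f : R →+* S) :
    IsHurwitzRadon fun i => f.mapMatrix (A i) where
  transpose_eq i := by
    rw [← map_neg, ← hA.transpose_eq]; rfl
  mul_self i := by rw [← map_mul, hA.mul_self, map_neg, map_one]
  anticomm i j hij := by rw [← map_mul, ← map_mul, hA.anticomm i j hij, map_neg]

lemma reindex {A : ι → Matrix n n R} (hA : IsHurwitzRadon A) (f : κ ≃ ι) (e : n ≃ m) :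
    IsHurwitzRadon fun k => Matrix.reindexAlgEquiv R R e (A (f k)) where
  transpose_eq k := by
    rw [← map_neg, ← hA.transpose_eq]; rfl
  mul_self k := by rw [← map_mul, hA.mul_self, map_neg, map_one]
  anticomm k l hkl := by
    rw [← map_mul, ← map_mul, hA.anticomm _ _ (f.injective.ne hkl), map_neg]

lemma kronecker_one {A : ι → Matrix n n R} (hA : IsHurwitzRadon A) :
    IsHurwitzRadon fun i => A i ⊗ₖ (1 : Matrix m m R) where
  transpose_eq i := by
    rw [← Matrix.kroneckerMap_transpose, hA.transpose_eq, Matrix.transpose_one,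
      Matrix.neg_kronecker]
  mul_self i := by
    rw [← Matrix.mul_kronecker_mul, hA.mul_self, one_mul, Matrix.neg_kronecker,
      Matrix.one_kronecker_one]
  anticomm i j hij := by
    rw [← Matrix.mul_kronecker_mul, ← Matrix.mul_kronecker_mul, hA.anticomm i j hij,
      Matrix.neg_kronecker]

lemma one_kronecker {A : ι → Matrix n n R} (hA : IsHurwitzRadon A) :
    IsHurwitzRadon fun i => (1 : Matrix m m R) ⊗ₖ A i where
  transpose_eq i := by
    rw [← Matrix.kroneckerMap_transpose, hA.transpose_eq, Matrix.transpose_one,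
      Matrix.kronecker_neg]
  mul_self i := by
    rw [← Matrix.mul_kronecker_mul, hA.mul_self, one_mul, Matrix.kronecker_neg,
      Matrix.one_kronecker_one]
  anticomm i j hij := by
    rw [← Matrix.mul_kronecker_mul, ← Matrix.mul_kronecker_mul, hA.anticomm i j hij,
      Matrix.kronecker_neg]

/-- The doubling construction: two mutually commuting Hurwitz–Radon families on the same space
combine to a family with one more member on twice the space. -/
def double (A : ι → Matrix n n R) (B : κ → Matrix n n R) :
    Option (ι ⊕ κ) → Matrix (n ⊕ n) (n ⊕ n) R
  | none => Matrix.fromBlocks 0 (-1) 1 0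
  | some (.inl i) => Matrix.fromBlocks (A i) 0 0 (-A i)
  | some (.inr k) => Matrix.fromBlocks 0 (B k) (B k) 0

lemma isHurwitzRadon_double {A : ι → Matrix n n R} {B : κ → Matrix n n R}
    (hA : IsHurwitzRadon A) (hB : IsHurwitzRadon B) (hAB : ∀ i k, Commute (A i) (B k)) :
    IsHurwitzRadon (double A B) where
  transpose_eq i := by
    rcases i with _ | i | i <;>
      simp [double, Matrix.fromBlocks_transpose, Matrix.fromBlocks_neg, hA.transpose_eq,
        hB.transpose_eq]
  mul_self i := by
    rw [← Matrix.fromBlocks_one, Matrix.fromBlocks_neg]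
    rcases i with _ | i | i <;>
      simp [double, Matrix.fromBlocks_multiply, hA.mul_self, hB.mul_self]
  anticomm i j hij := by
    rcases i with _ | i | i <;> rcases j with _ | j | j <;>
      simp only [ne_eq, not_true_eq_false, Option.some.injEq, Sum.inl.injEq, Sum.inr.injEq] at hij
    all_goals simp [double, Matrix.fromBlocks_multiply, Matrix.fromBlocks_neg]
    · exact hA.anticomm i j hij
    · exact (hAB i j).eq
    · exact (hAB j i).eq.symm
    · exact hB.anticomm i j hij

/-- Left multiplication by the quaternion units. -/
def quaternionLeft : Fin 3 → Matrix (Fin 4) (Fin 4) ℤ :=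
  ![!![0, -1, 0, 0; 1, 0, 0, 0; 0, 0, 0, -1; 0, 0, 1, 0],
    !![0, 0, -1, 0; 0, 0, 0, 1; 1, 0, 0, 0; 0, -1, 0, 0],
    !![0, 0, 0, -1; 0, 0, -1, 0; 0, 1, 0, 0; 1, 0, 0, 0]]

/-- Right multiplication by the quaternion units. -/
def quaternionRight : Fin 3 → Matrix (Fin 4) (Fin 4) ℤ :=
  ![!![0, -1, 0, 0; 1, 0, 0, 0; 0, 0, 0, 1; 0, 0, -1, 0],
    !![0, 0, -1, 0; 0, 0, 0, -1; 1, 0, 0, 0; 0, 1, 0, 0],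
    !![0, 0, 0, -1; 0, 0, 1, 0; 0, -1, 0, 0; 1, 0, 0, 0]]

lemma isHurwitzRadon_quaternionLeft : IsHurwitzRadon quaternionLeft :=
  ⟨by decide, by decide, by decide⟩

lemma isHurwitzRadon_quaternionRight : IsHurwitzRadon quaternionRight :=
  ⟨by decide, by decide, by decide⟩

lemma commute_quaternionLeft_quaternionRight (i j : Fin 3) :
    Commute (quaternionLeft i) (quaternionRight j) := by
  have h : ∀ i j, quaternionLeft i * quaternionRight j = quaternionRight j * quaternionLeft i := by
    decide
  exact h i j

lemma exists_fin [Fintype ι] {A : ι → Matrix n n R} (hA : IsHurwitzRadon A) {k d : ℕ}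
    (hk : Fintype.card ι = k) (hd : Fintype.card n = d) :
    ∃ B : Fin k → Matrix (Fin d) (Fin d) R, IsHurwitzRadon B :=
  ⟨_, hA.reindex (Fintype.equivFinOfCardEq hk).symm (Fintype.equivFinOfCardEq hd)⟩

lemma exists_two_pow_of_le_three {b : ℕ} (hb : b ≤ 3) :
    ∃ A : Fin (2 ^ b - 1) → Matrix (Fin (2 ^ b)) (Fin (2 ^ b)) ℤ, IsHurwitzRadon A := by
  interval_cases b
  · exact ⟨_, of_isEmpty (ι := Fin 0) 0⟩
  · exact (isHurwitzRadon_double (of_isEmpty (ι := Empty) (n := Unit) (R := ℤ) 0)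
      (of_isEmpty (ι := Empty) 0) nofun).exists_fin (by simp) (by simp)
  · exact ⟨_, isHurwitzRadon_quaternionLeft⟩
  · exact (isHurwitzRadon_double isHurwitzRadon_quaternionLeft isHurwitzRadon_quaternionRight
      commute_quaternionLeft_quaternionRight).exists_fin (by simp) (by simp)

lemma exists_two_pow (a : ℕ) {b : ℕ} (hb : b ≤ 3) :
    ∃ A : Fin (8 * a + 2 ^ b - 1) → Matrix (Fin (2 ^ (4 * a + b))) (Fin (2 ^ (4 * a + b))) ℤ,
      IsHurwitzRadon A := by
  induction a with
  | zero =>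
    obtain ⟨A, hA⟩ := exists_two_pow_of_le_three hb
    exact hA.exists_fin (by simp) (by simp)
  | succ a ih =>
    obtain ⟨A, hA⟩ := ih
    obtain ⟨B, hB⟩ := exists_two_pow_of_le_three le_rfl
    refine (isHurwitzRadon_double (hA.kronecker_one (m := Fin (2 ^ 3)))
      (hB.one_kronecker (m := Fin (2 ^ (4 * a + b)))) fun i k => ?_).exists_fin ?_ ?_
    · simp [commute_iff_eq, ← Matrix.mul_kronecker_mul]
    · have := Nat.one_le_two_pow (n := b)
      simp
      omega
    · simp
      ring

lemma orthonormal_mulVec {A : ι → Matrix n n ℝ} (hA : IsHurwitzRadon A)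
    {x : EuclideanSpace ℝ n} (hx : ‖x‖ = 1) :
    Orthonormal ℝ fun i => WithLp.toLp 2 (A i *ᵥ x.ofLp) := by
  classical
  rw [orthonormal_iff_ite]
  intro i j
  have h : inner ℝ (WithLp.toLp 2 (A i *ᵥ x.ofLp)) (WithLp.toLp 2 (A j *ᵥ x.ofLp)) =
      -((A i * A j) *ᵥ x.ofLp ⬝ᵥ x.ofLp) := by
    rw [EuclideanSpace.inner_toLp_toLp, star_trivial, Matrix.dotProduct_mulVec,
      ← Matrix.mulVec_transpose, hA.transpose_eq, Matrix.mulVec_mulVec,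
      neg_mul, Matrix.neg_mulVec, neg_dotProduct]
  rw [h]
  split_ifs with hij
  · subst hij
    rw [hA.mul_self, Matrix.neg_mulVec, Matrix.one_mulVec, neg_dotProduct, neg_neg]
    have h := real_inner_self_eq_norm_sq x
    rwa [EuclideanSpace.inner_eq_star_dotProduct, star_trivial, hx, one_pow] at h
  · rw [Matrix.mulVec_dotProduct_eq_zero, neg_zero]
    rw [Matrix.transpose_mul, hA.transpose_eq, hA.transpose_eq, neg_mul_neg,
      hA.anticomm i j hij, neg_neg]

end IsHurwitzRadon

/-- **Radon–Hurwitz vector fields on spheres.**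
Write `N + 1 = (2t+1) · 2^(4a+b)` with `b ≤ 3` and set `n := 8a + 2^b - 1`. Then there
exist `n` continuous tangent vector fields on the unit sphere `S^N ⊆ ℝ^(N+1)` which are
linearly independent at every point. -/
theorem radon_hurwitz_vector_fields (N t a b : ℕ) (hb : b ≤ 3)
    (hN : N + 1 = (2 * t + 1) * 2 ^ (4 * a + b)) :
    ∃ V : Fin (8 * a + 2 ^ b - 1) →
        (Metric.sphere (0 : EuclideanSpace ℝ (Fin (N + 1))) 1 →
          EuclideanSpace ℝ (Fin (N + 1))),
      (∀ i, Continuous (V i)) ∧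
      ∀ x : Metric.sphere (0 : EuclideanSpace ℝ (Fin (N + 1))) 1,
        (∀ i, ⟪V i x, (x : EuclideanSpace ℝ (Fin (N + 1)))⟫ = 0) ∧
        LinearIndependent ℝ (fun i => V i x) := by
  obtain ⟨A, hA⟩ := IsHurwitzRadon.exists_two_pow a hb
  obtain ⟨B, hB⟩ := ((hA.map (Int.castRingHom ℝ)).one_kronecker (m := Fin (2 * t + 1))).exists_fin
    (Fintype.card_fin _) (d := N + 1) (by simp [hN])
  refine ⟨fun i x => WithLp.toLp 2 (B i *ᵥ x.1.ofLp), fun i => by fun_prop, fun x =>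
    ⟨fun i => ?_, (hB.orthonormal_mulVec (by simp)).linearIndependent⟩⟩
  rw [EuclideanSpace.inner_eq_star_dotProduct, star_trivial, dotProduct_comm]
  exact Matrix.mulVec_dotProduct_eq_zero (hB.transpose_eq i) _
end
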